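/- Let ℍ⁺_ℚ = {u ∈ ℍ⁺ : u = x+iy with x,y ∈ ℚ}. For every t ∈ ℝ and every p ∈ (1,∞), the closed linear span of the countable set Λ_t = {b_u·(D_t b_w) : u, w ∈ ℍ⁺_ℚ} equals H^p(ℝ), where D_t b_w = b_{w−t}, i.e. (D_t b_w)(x) = 1/(x−t+w). -/

import Mathlib

open MeasureTheory Complex Filter Topology
open scoped ENNReal NNReal

noncomputable section

/-- `L^p(ℝ)` with complex values. -/
abbrev LpR (p : ℝ≥0∞) := MeasureTheory.Lp ℂ p (volume : Measure ℝ)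

/-- The Bochner space `L^p(ℝ; L^q(ℝ))`. -/
abbrev LpLq (p q : ℝ≥0∞) [Fact (1 ≤ q)] := MeasureTheory.Lp (LpR q) p (volume : Measure ℝ)

/-- `T` is the operator of multiplication by `φ`. -/
def IsMulOp (p : ℝ≥0∞) [Fact (1 ≤ p)] (φ : ℝ → ℂ) (T : LpR p →L[ℂ] LpR p) : Prop :=
  ∀ f : LpR p, (T f : ℝ → ℂ) =ᵐ[volume] fun x => φ x * (f : ℝ → ℂ) x

/-- `T` is the operator of translation by `μ`: `(T f)(x) = f (x - μ)`. -/
def IsTransOp (p : ℝ≥0∞) [Fact (1 ≤ p)] (μ : ℝ) (T : LpR p →L[ℂ] LpR p) : Prop :=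
  ∀ f : LpR p, (T f : ℝ → ℂ) =ᵐ[volume] fun x => (f : ℝ → ℂ) (x - μ)

/-- A set of operators is closed in the strong operator topology (the topology of
pointwise norm convergence) if it contains every operator which is an SOT-limit point. -/
def IsSOTClosed (p : ℝ≥0∞) [Fact (1 ≤ p)] (S : Set (LpR p →L[ℂ] LpR p)) : Prop :=
  ∀ T : LpR p →L[ℂ] LpR p,
    (⇑T ∈ closure ((fun A : LpR p →L[ℂ] LpR p => (A : LpR p → LpR p)) '' S)) → T ∈ S

/-- The generators of the parabolic algebra: multiplications `M_λ`, `λ ≥ 0`, and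
translations `D_μ`, `μ ≥ 0`. -/
def parabolicGens (p : ℝ≥0∞) [Fact (1 ≤ p)] : Set (LpR p →L[ℂ] LpR p) :=
  {T | ∃ l : ℝ, 0 ≤ l ∧ IsMulOp p (fun x => Complex.exp (Complex.I * l * x)) T} ∪
  {T | ∃ m : ℝ, 0 ≤ m ∧ IsTransOp p m T}

/-- The parabolic algebra: the smallest SOT-closed subalgebra of `B(L^p(ℝ))` containing
the multiplication semigroup and the translation semigroup. -/
def parabolicAlgebra (p : ℝ≥0∞) [Fact (1 ≤ p)] : Set (LpR p →L[ℂ] LpR p) :=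
  ⋂₀ {S | parabolicGens p ⊆ S ∧ IsSOTClosed p S ∧
      ∃ A : Subalgebra ℂ (LpR p →L[ℂ] LpR p), (A : Set (LpR p →L[ℂ] LpR p)) = S}

/-- The Hardy space `H^p(ℝ)`, as a subset of `L^p(ℝ)`. -/
def hardy (p : ℝ≥0∞) [Fact (1 ≤ p)] : Set (LpR p) :=
  {f | ∀ u : ℂ, 0 < u.im → ∫ x : ℝ, (f : ℝ → ℂ) x / ((x : ℂ) + u) = 0}

/-- `L^p[t,∞)`, the subspace of functions vanishing a.e. on `(-∞, t)`. -/
def LpHalfLine (p : ℝ≥0∞) [Fact (1 ≤ p)] (t : ℝ) : Set (LpR p) :=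
  {f | ∀ᵐ x : ℝ, x < t → (f : ℝ → ℂ) x = 0}

/-- The image of the Hardy space under multiplication by the function `φ`. -/
def mulHardy (p : ℝ≥0∞) [Fact (1 ≤ p)] (φ : ℝ → ℂ) : Set (LpR p) :=
  {g | ∃ f ∈ hardy p, (g : ℝ → ℂ) =ᵐ[volume] fun x => φ x * (f : ℝ → ℂ) x}

/-- The Fourier binest algebra: operators leaving invariant each `L^p[t,∞)` and each
`e^{iλx}H^p(ℝ)`. -/
def fourierBinest (p : ℝ≥0∞) [Fact (1 ≤ p)] : Set (LpR p →L[ℂ] LpR p) :=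
  {T | (∀ t : ℝ, ∀ f ∈ LpHalfLine p t, T f ∈ LpHalfLine p t) ∧
       (∀ l : ℝ, ∀ f ∈ mulHardy p (fun x => Complex.exp (Complex.I * l * x)),
          T f ∈ mulHardy p (fun x => Complex.exp (Complex.I * l * x)))}

/-- `T` is the `(p,q)`-integral operator with kernel `k`. -/
def IsIntOp (p q : ℝ≥0∞) [Fact (1 ≤ p)] [Fact (1 ≤ q)] (k : LpLq p q)
    (T : LpR p →L[ℂ] LpR p) : Prop :=
  ∀ f : LpR p, (T f : ℝ → ℂ) =ᵐ[volume]
    fun x => ∫ y : ℝ, ((k : ℝ → LpR q) x : ℝ → ℂ) y * (f : ℝ → ℂ) y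

/-- `G^p`, the set of `(p,q)`-integral operators on `L^p(ℝ)`. -/
def Gp (p q : ℝ≥0∞) [Fact (1 ≤ p)] [Fact (1 ≤ q)] : Set (LpR p →L[ℂ] LpR p) :=
  {T | ∃ k : LpLq p q, IsIntOp p q k T}


/-- The Cauchy kernel `b_u(x) = 1 / (x + u)`. -/
def cauchyKernel (u : ℂ) (x : ℝ) : ℂ := ((x : ℂ) + u)⁻¹

theorem ofReal_add_ne_zero {u : ℂ} (hu : 0 < u.im) (x : ℝ) : (x : ℂ) + u ≠ 0 := fun h => by
  have := congrArg Complex.im h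
  simp at this
  exact hu.ne' this

theorem continuous_cauchyKernel {u : ℂ} (hu : 0 < u.im) : Continuous (cauchyKernel u) :=
  (by fun_prop : Continuous fun x : ℝ => (x : ℂ) + u).inv₀ (ofReal_add_ne_zero hu)

theorem im_le_norm_ofReal_add {u : ℂ} (x : ℝ) : u.im ≤ ‖(x : ℂ) + u‖ := by
  simpa using (le_abs_self _).trans (Complex.abs_im_le_norm ((x : ℂ) + u))

theorem norm_cauchyKernel_le {u : ℂ} (hu : 0 < u.im) (x : ℝ) : ‖cauchyKernel u x‖ ≤ u.im⁻¹ := by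
  rw [cauchyKernel, norm_inv]
  exact inv_anti₀ hu (im_le_norm_ofReal_add x)

theorem norm_cauchyKernel_le_one_add_norm {u : ℂ} (hu : 0 < u.im) (x : ℝ) :
    ‖cauchyKernel u x‖ ≤ (1 + (1 + ‖u‖) / u.im) * (1 + ‖x‖)⁻¹ := by
  have h0 : 0 < ‖(x : ℂ) + u‖ := hu.trans_le (im_le_norm_ofReal_add x)
  have h1 : ‖x‖ ≤ ‖(x : ℂ) + u‖ + ‖u‖ := by
    have := norm_sub_le ((x : ℂ) + u) u
    simpa using this
  have h2 : 1 + ‖u‖ ≤ (1 + ‖u‖) / u.im * ‖(x : ℂ) + u‖ := by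
    rw [div_mul_eq_mul_div, le_div_iff₀ hu]
    exact mul_le_mul_of_nonneg_left (im_le_norm_ofReal_add x) (by positivity)
  rw [cauchyKernel, norm_inv, ← div_eq_mul_inv, le_div_iff₀ (by positivity),
    inv_mul_le_iff₀ h0]
  nlinarith

theorem memLp_cauchyKernel {p : ℝ≥0∞} (hp : 1 < p) (hp' : p ≠ ⊤) {u : ℂ} (hu : 0 < u.im) :
    MemLp (cauchyKernel u) p (volume : Measure ℝ) := by
  have hr : 1 < p.toReal := by
    rw [← ENNReal.toReal_one]; exact (ENNReal.toReal_lt_toReal (by simp) hp').2 hp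
  have hm : AEStronglyMeasurable (fun x : ℝ => (1 + ‖x‖)⁻¹) :=
    Continuous.aestronglyMeasurable
      ((by fun_prop : Continuous fun x : ℝ => 1 + ‖x‖).inv₀ fun x => by positivity)
  have h : MemLp (fun x : ℝ => (1 + ‖x‖)⁻¹) p := by
    rw [← integrable_norm_rpow_iff hm (by positivity) hp']
    refine (integrable_one_add_norm (E := ℝ) (r := p.toReal) (by simpa using hr)).congr ?_
    refine Eventually.of_forall fun x => ?_
    have : (0 : ℝ) ≤ 1 + ‖x‖ := by positivity
    simp only [norm_inv, Real.norm_of_nonneg this, Real.rpow_neg this, Real.inv_rpow this]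
  refine h.of_le_mul (c := 1 + (1 + ‖u‖) / u.im)
    (continuous_cauchyKernel hu).aestronglyMeasurable (Eventually.of_forall fun x => ?_)
  rw [Real.norm_of_nonneg (by positivity : (0 : ℝ) ≤ (1 + ‖x‖)⁻¹)]
  exact norm_cauchyKernel_le_one_add_norm hu x

theorem cauchyKernel_sub {u v : ℂ} (hu : 0 < u.im) (hv : 0 < v.im) (x : ℝ) :
    cauchyKernel u x - cauchyKernel v x = (v - u) * (cauchyKernel u x * cauchyKernel v x) := by
  have h1 := ofReal_add_ne_zero hu x
  have h2 := ofReal_add_ne_zero hv x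
  simp only [cauchyKernel]
  field_simp
  ring

theorem memLp_cauchyKernel_mul {p : ℝ≥0∞} (hp : 1 < p) (hp' : p ≠ ⊤) {u v : ℂ}
    (hu : 0 < u.im) (hv : 0 < v.im) :
    MemLp (fun x => cauchyKernel u x * cauchyKernel v x) p (volume : Measure ℝ) :=
  (memLp_cauchyKernel hp hp' hv).of_le_mul (c := u.im⁻¹)
    ((continuous_cauchyKernel hu).mul (continuous_cauchyKernel hv)).aestronglyMeasurable
    (Eventually.of_forall fun x => by
      rw [norm_mul]
      gcongr
      exact norm_cauchyKernel_le hu x)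

theorem integrable_cauchyKernel_mul {u v : ℂ} (hu : 0 < u.im) (hv : 0 < v.im) :
    Integrable fun x => cauchyKernel u x * cauchyKernel v x :=
  (memLp_cauchyKernel (by norm_num) (by norm_num) hu : MemLp _ 2 _).integrable_mul
    (memLp_cauchyKernel (by norm_num) (by norm_num) hv : MemLp _ 2 _)

theorem tendsto_cauchyKernel {u : ℂ} (hu : 0 < u.im) :
    Tendsto (cauchyKernel u) (cocompact ℝ) (𝓝 0) := by
  refine squeeze_zero_norm (norm_cauchyKernel_le_one_add_norm hu) ?_
  rw [← mul_zero (1 + (1 + ‖u‖) / u.im)]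
  exact ((tendsto_atTop_add_const_left _ _ (tendsto_norm_cocompact_atTop (E := ℝ))).inv_tendsto_atTop
    ).const_mul _

theorem hasDerivAt_cauchyKernel {u : ℂ} (hu : 0 < u.im) (x : ℝ) :
    HasDerivAt (cauchyKernel u) (-(cauchyKernel u x * cauchyKernel u x)) x := by
  have h : HasDerivAt (fun y : ℝ => (y : ℂ) + u) 1 x :=
    ((hasDerivAt_id x).ofReal_comp).add_const u
  refine (h.inv (ofReal_add_ne_zero hu x)).congr_deriv ?_
  have := ofReal_add_ne_zero hu x
  simp only [cauchyKernel]
  field_simp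

theorem ofReal_add_mul_cauchyKernel_mem_slitPlane {u v : ℂ} (hu : 0 < u.im) (hv : 0 < v.im)
    (x : ℝ) : ((x : ℂ) + u) * cauchyKernel v x ∈ Complex.slitPlane := by
  rw [Complex.mem_slitPlane_iff_not_le_zero]
  intro h
  set z := ((x : ℂ) + u) * cauchyKernel v x with hz
  have h1 : (x : ℂ) + u = z * ((x : ℂ) + v) := by
    rw [hz, cauchyKernel, inv_mul_cancel_right₀ (ofReal_add_ne_zero hv x)]
  have h2 := congrArg Complex.im h1
  obtain ⟨h3, h4⟩ := Complex.le_def.1 h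
  simp only [Complex.zero_re, Complex.zero_im] at h3 h4
  simp [h4] at h2
  nlinarith

theorem hasDerivAt_log_div {u v : ℂ} (hu : 0 < u.im) (hv : 0 < v.im) (x : ℝ) :
    HasDerivAt (fun y : ℝ => Complex.log (((y : ℂ) + u) * cauchyKernel v y))
      ((v - u) * (cauchyKernel u x * cauchyKernel v x)) x := by
  have h : HasDerivAt (fun y : ℝ => (y : ℂ) + u) 1 x :=
    ((hasDerivAt_id x).ofReal_comp).add_const u
  refine ((h.mul (hasDerivAt_cauchyKernel hv x)).clog_real
    (ofReal_add_mul_cauchyKernel_mem_slitPlane hu hv x)).congr_deriv ?_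
  have h1 := ofReal_add_ne_zero hu x
  have h2 := ofReal_add_ne_zero hv x
  simp only [Pi.mul_apply, cauchyKernel]
  field_simp
  ring

theorem tendsto_log_div {u v : ℂ} (hv : 0 < v.im) :
    Tendsto (fun y : ℝ => Complex.log (((y : ℂ) + u) * cauchyKernel v y)) (cocompact ℝ) (𝓝 0) := by
  have h : Tendsto (fun y : ℝ => ((y : ℂ) + u) * cauchyKernel v y) (cocompact ℝ) (𝓝 1) := by
    have h1 := ((tendsto_cauchyKernel hv).const_mul (u - v)).const_add 1
    rw [mul_zero, add_zero] at h1
    refine h1.congr fun y => ?_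
    have h2 := ofReal_add_ne_zero hv y
    simp only [cauchyKernel]
    field_simp
    ring
  have := (continuousAt_clog Complex.one_mem_slitPlane).tendsto.comp h
  rwa [Complex.log_one] at this

theorem integral_cauchyKernel_mul {u v : ℂ} (hu : 0 < u.im) (hv : 0 < v.im) :
    ∫ x, cauchyKernel u x * cauchyKernel v x = 0 := by
  have hInt := integrable_cauchyKernel_mul hu hv
  rcases eq_or_ne u v with rfl | huv
  · have h := integral_of_hasDerivAt_of_tendsto (hasDerivAt_cauchyKernel hu) hInt.neg
      ((tendsto_cauchyKernel hu).mono_left atBot_le_cocompact)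
      ((tendsto_cauchyKernel hu).mono_left atTop_le_cocompact)
    simpa [integral_neg] using h
  · have h := integral_of_hasDerivAt_of_tendsto (hasDerivAt_log_div hu hv) (hInt.const_mul _)
      ((tendsto_log_div hv).mono_left atBot_le_cocompact)
      ((tendsto_log_div hv).mono_left atTop_le_cocompact)
    rw [integral_const_mul, sub_zero] at h
    exact (mul_eq_zero.1 h).resolve_left (sub_ne_zero.2 huv.symm)

theorem integral_cauchyKernel_mul_mul {u v w : ℂ} (hu : 0 < u.im) (hv : 0 < v.im)
    (hw : 0 < w.im) :
    ∫ x, cauchyKernel u x * cauchyKernel v x * cauchyKernel w x = 0 := by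
  have key : ∀ {a b c : ℂ}, 0 < a.im → 0 < b.im → 0 < c.im → a ≠ b →
      ∫ x, cauchyKernel a x * cauchyKernel b x * cauchyKernel c x = 0 := by
    intro a b c ha hb hc hab
    have h : (b - a) * ∫ x, cauchyKernel a x * cauchyKernel b x * cauchyKernel c x = 0 := by
      rw [← integral_const_mul]
      calc _ = ∫ x, (cauchyKernel a x * cauchyKernel c x - cauchyKernel b x * cauchyKernel c x) :=
            integral_congr_ae (Eventually.of_forall fun x => by
              simp only
              rw [← sub_mul, cauchyKernel_sub ha hb]; ring)
        _ = 0 := by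
          rw [integral_sub (integrable_cauchyKernel_mul ha hc)
            (integrable_cauchyKernel_mul hb hc), integral_cauchyKernel_mul ha hc,
            integral_cauchyKernel_mul hb hc, sub_zero]
    exact (mul_eq_zero.1 h).resolve_left (sub_ne_zero.2 hab.symm)
  by_cases huv : u = v
  · by_cases hvw : v = w
    · subst huv hvw
      have hd : ∀ x, HasDerivAt (fun y => cauchyKernel u y * cauchyKernel u y)
          (-2 * (cauchyKernel u x * cauchyKernel u x * cauchyKernel u x)) x := fun x =>
        ((hasDerivAt_cauchyKernel hu x).mul (hasDerivAt_cauchyKernel hu x)).congr_deriv (by ring)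
      have ht : Tendsto (fun y => cauchyKernel u y * cauchyKernel u y) (cocompact ℝ) (𝓝 0) := by
        simpa using (tendsto_cauchyKernel hu).mul (tendsto_cauchyKernel hu)
      have hi : Integrable fun x => cauchyKernel u x * cauchyKernel u x * cauchyKernel u x :=
        (integrable_cauchyKernel_mul hu hu).mul_bdd (c := u.im⁻¹)
          (continuous_cauchyKernel hu).aestronglyMeasurable
          (Eventually.of_forall (norm_cauchyKernel_le hu))
      have h := integral_of_hasDerivAt_of_tendsto hd (hi.const_mul _)
        (ht.mono_left atBot_le_cocompact) (ht.mono_left atTop_le_cocompact)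
      rw [integral_const_mul, sub_zero] at h
      exact (mul_eq_zero.1 h).resolve_left (by norm_num)
    · rw [← key hv hw hu hvw]
      congr 1 with x
      ring
  · exact key hu hv hw huv

/-- A Bochner integral of `L^p` functions is computed pointwise almost everywhere. -/
theorem Lp_integral_ae_eq {p : ℝ≥0∞} [Fact (1 ≤ p)] {φ : ℝ → LpR p} (hφ : Integrable φ)
    {k : ℝ → ℝ → ℂ}
    (hk : AEStronglyMeasurable (Function.uncurry k) ((volume : Measure ℝ).prod volume))
    (h : ∀ s, (φ s : ℝ → ℂ) =ᵐ[volume] k s) :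
    ((∫ s, φ s : LpR p) : ℝ → ℂ) =ᵐ[volume] fun x => ∫ s, k s x := by
  have hq : Fact (1 ≤ ENNReal.conjExponent p) := ⟨by
    rw [ENNReal.conjExponent]; exact le_self_add⟩
  have hA : ∀ A : Set ℝ, MeasurableSet A → volume A < ⊤ →
      IntegrableOn (fun x => ∫ s, k s x) A ∧
      ∫ x in A, ((∫ s, φ s : LpR p) : ℝ → ℂ) x = ∫ x in A, ∫ s, k s x := by
    intro A hA hA'
    set g : LpR (ENNReal.conjExponent p) :=
      indicatorConstLp (ENNReal.conjExponent p) hA hA'.ne 1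
    have hnorm : ∀ f : LpR p, IntegrableOn f A ∧ ∫ x in A, ‖(f : ℝ → ℂ) x‖ ≤ ‖f‖ * ‖g‖ := by
      intro f
      have hInt : IntegrableOn f A := by
        have : IsFiniteMeasure (volume.restrict A) := ⟨by simpa using hA'⟩
        exact ((Lp.memLp f).restrict A).integrable Fact.out
      refine ⟨hInt, ?_⟩
      have h1 : (f • g : LpR 1) =ᵐ[volume] A.indicator f := by
        filter_upwards [Lp.coeFn_lpSMul (r := 1) f g, indicatorConstLp_coeFn
          (p := ENNReal.conjExponent p) (hs := hA) (hμs := hA'.ne) (c := (1 : ℂ))] with x h1 h2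
        rw [h1, Pi.smul_apply', h2]
        by_cases hxA : x ∈ A <;> simp [hxA]
      refine le_trans (le_of_eq ?_) (Lp.norm_smul_le (r := 1) f g)
      rw [L1.norm_eq_integral_norm, ← integral_indicator hA]
      refine integral_congr_ae ?_
      filter_upwards [h1] with x hx
      rw [hx, norm_indicator_eq_indicator_norm]
    set T : LpR p →L[ℂ] ℂ := ((ContinuousLinearMap.mul ℂ ℂ).lpPairing volume p
      (ENNReal.conjExponent p)).flip g
    have hT : ∀ f : LpR p, T f = ∫ x in A, (f : ℝ → ℂ) x := by
      intro f
      simp only [T, ContinuousLinearMap.flip_apply, ContinuousLinearMap.lpPairing_eq_integral,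
        ContinuousLinearMap.mul_apply']
      rw [← integral_indicator hA]
      refine integral_congr_ae ?_
      filter_upwards [indicatorConstLp_coeFn (p := ENNReal.conjExponent p) (hs := hA)
        (hμs := hA'.ne) (c := (1 : ℂ))] with x hx
      simp only [g, hx]
      by_cases hxA : x ∈ A <;> simp [hxA]
    have hkA : AEStronglyMeasurable (Function.uncurry k)
        ((volume : Measure ℝ).prod (volume.restrict A)) :=
      hk.mono_ac (Measure.AbsolutelyContinuous.rfl.prod Measure.absolutelyContinuous_restrict)
    have hInt : Integrable (Function.uncurry k)
        ((volume : Measure ℝ).prod (volume.restrict A)) := by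
      rw [integrable_prod_iff hkA]
      refine ⟨Eventually.of_forall fun s =>
        (hnorm (φ s)).1.congr (ae_restrict_of_ae (h s)), ?_⟩
      refine (hφ.norm.mul_const ‖g‖).mono' hkA.norm.integral_prod_right'
        (Eventually.of_forall fun s => ?_)
      rw [Real.norm_of_nonneg (integral_nonneg fun _ => norm_nonneg _)]
      refine le_trans (le_of_eq (integral_congr_ae ?_)) (hnorm (φ s)).2
      filter_upwards [ae_restrict_of_ae (h s)] with x hx
      simp [Function.uncurry, hx]
    refine ⟨hInt.integral_prod_right, ?_⟩
    rw [← hT, ← T.integral_comp_comm hφ, ← integral_integral_swap hInt]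
    congr 1 with s
    rw [hT]
    exact integral_congr_ae (ae_restrict_of_ae (h s))
  refine ae_eq_of_forall_setIntegral_eq_of_sigmaFinite (fun A hA1 hA2 => ?_)
    (fun A h1 h2 => (hA A h1 h2).1) fun A h1 h2 => (hA A h1 h2).2
  have : IsFiniteMeasure (volume.restrict A) := ⟨by simpa using hA2⟩
  exact ((Lp.memLp _).restrict A).integrable Fact.out

theorem one_lt_conjExponent_ne_top {p : ℝ≥0∞} (hp : 1 < p) (hp' : p ≠ ⊤) :
    1 < ENNReal.conjExponent p ∧ ENNReal.conjExponent p ≠ ⊤ := by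
  have h0 : p - 1 ≠ 0 := (tsub_pos_of_lt hp).ne'
  rw [ENNReal.conjExponent]
  refine ⟨ENNReal.lt_add_right (by simp) ?_, by simp [h0]⟩
  exact ENNReal.inv_ne_zero.2 (ENNReal.sub_ne_top hp')

/-- Pairing against `b_u`, as a continuous functional on `L^p`. -/
theorem exists_clm_integral_div {p : ℝ≥0∞} [Fact (1 ≤ p)] (hp : 1 < p) (hp' : p ≠ ⊤) {u : ℂ}
    (hu : 0 < u.im) :
    ∃ T : LpR p →L[ℂ] ℂ, ∀ f : LpR p, T f = ∫ x : ℝ, (f : ℝ → ℂ) x / ((x : ℂ) + u) := by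
  obtain ⟨hq1, hq2⟩ := one_lt_conjExponent_ne_top hp hp'
  have hq : Fact (1 ≤ ENNReal.conjExponent p) := ⟨hq1.le⟩
  refine ⟨((ContinuousLinearMap.mul ℂ ℂ).lpPairing volume p
      (ENNReal.conjExponent p)).flip (memLp_cauchyKernel hq1 hq2 hu).toLp, fun f => ?_⟩
  simp only [ContinuousLinearMap.flip_apply, ContinuousLinearMap.lpPairing_eq_integral,
    ContinuousLinearMap.mul_apply']
  refine integral_congr_ae ?_
  filter_upwards [(memLp_cauchyKernel hq1 hq2 hu).coeFn_toLp] with x hx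
  rw [hx, cauchyKernel, div_eq_mul_inv]

theorem isClosed_hardy {p : ℝ≥0∞} [Fact (1 ≤ p)] (hp : 1 < p) (hp' : p ≠ ⊤) :
    IsClosed (hardy p) := by
  simp only [hardy, Set.ofPred_forall]
  refine isClosed_iInter fun u => isClosed_iInter fun hu => ?_
  obtain ⟨T, hT⟩ := exists_clm_integral_div hp hp' hu
  simp only [← hT]
  exact isClosed_eq T.continuous continuous_const

theorem span_le_hardy {p : ℝ≥0∞} [Fact (1 ≤ p)] (hp : 1 < p) (hp' : p ≠ ⊤) {s : Set (LpR p)}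
    (hs : s ⊆ hardy p) : (Submodule.span ℂ s : Set (LpR p)) ⊆ hardy p := by
  intro f hf u hu
  obtain ⟨T, hT⟩ := exists_clm_integral_div hp hp' hu
  have : Submodule.span ℂ s ≤ LinearMap.ker (T : LpR p →ₗ[ℂ] ℂ) :=
    Submodule.span_le.2 fun g hg => by
      simpa [hT] using hs hg u hu
  rw [← hT]
  exact this hf

theorem tendsto_Lp_of_dominated {p : ℝ≥0∞} [Fact (1 ≤ p)] (hp' : p ≠ ⊤) {F : ℕ → LpR p}
    {f : LpR p} {m : ℕ → ℝ → ℂ} (hF : ∀ n, (F n : ℝ → ℂ) =ᵐ[volume] fun x => m n x * f x)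
    (hm : ∀ n x, ‖m n x‖ ≤ 1) (hlim : ∀ x, Tendsto (fun n => m n x) atTop (𝓝 1)) :
    Tendsto F atTop (𝓝 f) := by
  have hp0 : p ≠ 0 := (zero_lt_one.trans_le (Fact.out : 1 ≤ p)).ne'
  have hpos : 0 < p.toReal := ENNReal.toReal_pos hp0 hp'
  rw [Lp.tendsto_Lp_iff_tendsto_eLpNorm']
  simp only [eLpNorm_eq_lintegral_rpow_enorm_toReal hp0 hp']
  have hInt : Tendsto (fun n => ∫⁻ x, ‖((F n : ℝ → ℂ) - (f : ℝ → ℂ)) x‖ₑ ^ p.toReal) atTop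
      (𝓝 (∫⁻ _ : ℝ, 0)) := by
    refine tendsto_lintegral_of_dominated_convergence'
      (fun x => (2 * ‖(f : ℝ → ℂ) x‖ₑ) ^ p.toReal) (fun n => ?_) (fun n => ?_) ?_ ?_
    · exact (((Lp.aestronglyMeasurable _).sub (Lp.aestronglyMeasurable _)).enorm).pow_const _
    · filter_upwards [hF n] with x hx
      gcongr
      rw [Pi.sub_apply, hx, show m n x * f x - f x = (m n x - 1) * f x by ring, enorm_mul]
      gcongr
      refine (enorm_sub_le).trans ?_
      rw [← one_add_one_eq_two, enorm_one]
      gcongr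
      rw [← enorm_one (G := ℂ), enorm_le_iff_norm_le]
      simpa using hm n x
    · simp only [ENNReal.mul_rpow_of_nonneg _ _ hpos.le]
      rw [lintegral_const_mul' _ _ (by simp)]
      exact ENNReal.mul_ne_top (by simp)
        (lintegral_rpow_enorm_lt_top_of_eLpNorm_lt_top hp0 hp' (Lp.eLpNorm_lt_top f)).ne
    · filter_upwards [ae_all_iff.2 hF] with x hx
      have h1 : Tendsto (fun n => (m n x * f x - f x : ℂ)) atTop (𝓝 0) := by
        simpa using ((hlim x).mul_const (f x)).sub_const (f x)
      have h2 := (ENNReal.continuous_rpow_const (y := p.toReal)).tendsto _ |>.comp h1.enorm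
      simp only [enorm_zero, ENNReal.zero_rpow_of_pos hpos] at h2
      refine h2.congr fun n => ?_
      simp [hx n]
  have h3 := (ENNReal.continuous_rpow_const (y := 1 / p.toReal)).tendsto _ |>.comp hInt
  simpa [ENNReal.zero_rpow_of_pos (inv_pos.2 hpos), Function.comp_def] using h3

theorem integral_mem_of_isClosed {E : Type*} [NormedAddCommGroup E] [NormedSpace ℂ E]
    [CompleteSpace E] {S : Submodule ℂ E} (hS : IsClosed (S : Set E)) {φ : ℝ → E}
    (hφ : Integrable φ) (h : ∀ s, φ s ∈ S) : ∫ s, φ s ∈ S := by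
  have h1 := S.mkQL.integral_comp_comm hφ
  have h2 : ∀ s, S.mkQL (φ s) = 0 := fun s => by
    simpa using h s
  simp only [h2, integral_zero] at h1
  simpa using h1.symm

/-- The product `b_u b_w` in `L^p`, as a function of `u` in the upper half-plane. -/
def cauchyKernelMulLp {p : ℝ≥0∞} (hp : 1 < p) (hp' : p ≠ ⊤) {w : ℂ} (hw : 0 < w.im)
    (u : {u : ℂ // 0 < u.im}) : LpR p :=
  (memLp_cauchyKernel_mul hp hp' u.2 hw).toLp

theorem coeFn_cauchyKernelMulLp {p : ℝ≥0∞} (hp : 1 < p) (hp' : p ≠ ⊤) {w : ℂ} (hw : 0 < w.im)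
    (u : {u : ℂ // 0 < u.im}) :
    (cauchyKernelMulLp hp hp' hw u : ℝ → ℂ) =ᵐ[volume]
      fun x => cauchyKernel u x * cauchyKernel w x :=
  (memLp_cauchyKernel_mul hp hp' u.2 hw).coeFn_toLp

theorem continuous_cauchyKernelMulLp {p : ℝ≥0∞} [Fact (1 ≤ p)] (hp : 1 < p) (hp' : p ≠ ⊤)
    {w : ℂ} (hw : 0 < w.im) : Continuous (cauchyKernelMulLp hp hp' hw) := by
  rw [continuous_iff_continuousAt]
  intro v
  rw [ContinuousAt, tendsto_iff_norm_sub_tendsto_zero]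
  set g : LpR p := (memLp_cauchyKernel hp hp' hw).toLp
  have hbd : ∀ u : {u : ℂ // 0 < u.im},
      ‖cauchyKernelMulLp hp hp' hw u - cauchyKernelMulLp hp hp' hw v‖ ≤
        ‖(v : ℂ) - u‖ * ((u : ℂ).im⁻¹ * (v : ℂ).im⁻¹) * ‖g‖ := fun u => by
    refine Lp.norm_le_mul_norm_of_ae_le_mul ?_
    filter_upwards [Lp.coeFn_sub (cauchyKernelMulLp hp hp' hw u) (cauchyKernelMulLp hp hp' hw v),
      coeFn_cauchyKernelMulLp hp hp' hw u, coeFn_cauchyKernelMulLp hp hp' hw v,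
      (memLp_cauchyKernel hp hp' hw).coeFn_toLp] with x h1 h2 h3 h4
    rw [h1, Pi.sub_apply, h2, h3, h4, ← sub_mul, cauchyKernel_sub u.2 v.2, norm_mul, norm_mul,
      norm_mul]
    have hu := u.2
    gcongr
    · exact norm_cauchyKernel_le u.2 x
    · exact norm_cauchyKernel_le v.2 x
  refine squeeze_zero (fun _ => norm_nonneg _) hbd ?_
  have hc : ContinuousAt (fun u : {u : ℂ // 0 < u.im} =>
      ‖(v : ℂ) - u‖ * ((u : ℂ).im⁻¹ * (v : ℂ).im⁻¹) * ‖g‖) v := by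
    have hv : (v : ℂ).im ≠ 0 := v.2.ne'
    fun_prop (disch := assumption)
  simpa [ContinuousAt] using hc

theorem norm_toLp_cauchyKernel_eq {p : ℝ≥0∞} (hp : 1 < p) (hp' : p ≠ ⊤)
    {u : ℂ} (hu : 0 < u.im) (s : ℝ) (hs : 0 < (u - s).im) :
    ‖(memLp_cauchyKernel hp hp' hs).toLp‖ = ‖(memLp_cauchyKernel hp hp' hu).toLp‖ := by
  rw [Lp.norm_toLp, Lp.norm_toLp]
  congr 1
  rw [← eLpNorm_comp_measurePreserving (continuous_cauchyKernel hu).aestronglyMeasurable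
    (measurePreserving_sub_right volume s)]
  congr 1
  ext x
  simp only [cauchyKernel, Function.comp_apply]
  congr 1
  push_cast
  ring

theorem norm_cauchyKernelMulLp_le {p : ℝ≥0∞} [Fact (1 ≤ p)] (hp : 1 < p) (hp' : p ≠ ⊤)
    {u w : ℂ} (hu : 0 < u.im) (hw : 0 < w.im) (huw : u.im < w.im) (s : ℝ)
    (hs : 0 < (u - s).im) :
    ‖cauchyKernelMulLp hp hp' hw ⟨u - s, hs⟩‖ ≤
      (‖(memLp_cauchyKernel hp hp' hu).toLp‖ + ‖(memLp_cauchyKernel hp hp' hw).toLp‖) *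
        ‖cauchyKernel (w - u) s‖ := by
  have him : 0 < (w - u).im := by simpa using huw
  have hne := ofReal_add_ne_zero him s
  rw [← norm_toLp_cauchyKernel_eq hp hp' hu s hs, cauchyKernel, norm_inv, ← div_eq_mul_inv,
    le_div_iff₀ (norm_pos_iff.2 hne), mul_comm, ← norm_smul]
  refine le_trans (le_of_eq ?_) (norm_sub_le _ _)
  congr 1
  ext1
  filter_upwards [Lp.coeFn_smul ((s : ℂ) + (w - u)) (cauchyKernelMulLp hp hp' hw ⟨u - s, hs⟩),
    Lp.coeFn_sub (memLp_cauchyKernel hp hp' hs).toLp (memLp_cauchyKernel hp hp' hw).toLp,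
    coeFn_cauchyKernelMulLp hp hp' hw ⟨u - s, hs⟩,
    (memLp_cauchyKernel hp hp' hs).coeFn_toLp, (memLp_cauchyKernel hp hp' hw).coeFn_toLp]
    with x h1 h2 h3 h4 h5
  rw [h1, h2, Pi.smul_apply, Pi.sub_apply, h3, h4, h5, cauchyKernel_sub hs hw, smul_eq_mul]
  ring

/-- `b_w` times the Cauchy integral of `f` at height `u`. -/
theorem exists_mem_ae_eq_cauchyIntegral {p : ℝ≥0∞} [Fact (1 ≤ p)] (hp : 1 < p) (hp' : p ≠ ⊤)
    {S : Submodule ℂ (LpR p)} (hS : IsClosed (S : Set (LpR p)))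
    {u w : ℂ} (hu : 0 < u.im) (hw : 0 < w.im) (huw : u.im < w.im)
    (hmem : ∀ v, cauchyKernelMulLp hp hp' hw v ∈ S) (f : LpR p) :
    ∃ g ∈ S, (g : ℝ → ℂ) =ᵐ[volume]
      fun x => (∫ s, f s * cauchyKernel (u - s) x) * cauchyKernel w x := by
  obtain ⟨hq1, hq2⟩ := one_lt_conjExponent_ne_top hp hp'
  have him : 0 < (w - u).im := by simpa using huw
  have hs : ∀ s : ℝ, 0 < (u - s).im := fun s => by simpa using hu
  let B : ℝ → LpR p := fun s => cauchyKernelMulLp hp hp' hw ⟨u - s, hs s⟩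
  have hB : Continuous B := (continuous_cauchyKernelMulLp hp hp' hw).comp (by fun_prop)
  have hInt : Integrable fun s => (f : ℝ → ℂ) s • B s := by
    have h1 : Integrable fun s => (f : ℝ → ℂ) s * cauchyKernel (w - u) s :=
      (Lp.memLp f).integrable_mul (q := ENNReal.conjExponent p) (memLp_cauchyKernel hq1 hq2 him)
    refine (h1.norm.const_mul (‖(memLp_cauchyKernel hp hp' hu).toLp‖ +
      ‖(memLp_cauchyKernel hp hp' hw).toLp‖)).mono'
      ((Lp.aestronglyMeasurable f).smul hB.aestronglyMeasurable) (Eventually.of_forall fun s => ?_)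
    rw [norm_smul, norm_mul, mul_left_comm]
    gcongr
    exact norm_cauchyKernelMulLp_le hp hp' hu hw huw s (hs s)
  refine ⟨∫ s, (f : ℝ → ℂ) s • B s,
    integral_mem_of_isClosed hS hInt fun s => S.smul_mem _ (hmem _), ?_⟩
  have hc : Continuous fun z : ℝ × ℝ => cauchyKernel (u - z.1) z.2 * cauchyKernel w z.2 := by
    refine Continuous.mul ?_ ((continuous_cauchyKernel hw).comp continuous_snd)
    exact (by fun_prop : Continuous fun z : ℝ × ℝ => (z.2 : ℂ) + (u - z.1)).inv₀
      fun z => ofReal_add_ne_zero (hs z.1) z.2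
  have h := Lp_integral_ae_eq hInt
    (k := fun s x => f s * (cauchyKernel (u - s) x * cauchyKernel w x))
    (((Lp.stronglyMeasurable f).comp_measurable measurable_fst).mul
      hc.stronglyMeasurable).aestronglyMeasurable
    (fun s => by
      filter_upwards [Lp.coeFn_smul ((f : ℝ → ℂ) s) (B s),
        coeFn_cauchyKernelMulLp hp hp' hw ⟨u - s, hs s⟩] with x h1 h2
      rw [h1, Pi.smul_apply, h2, smul_eq_mul])
  filter_upwards [h] with x hx
  rw [hx, ← integral_mul_const]
  simp only [mul_assoc]

/-- The (unnormalised) Poisson integral of `f` at height `y`, as an `L^p`-valued integral of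
translates of `f`. -/
def poissonLp {p : ℝ≥0∞} [Fact (1 ≤ p)] (f : LpR p) (y : ℝ) : LpR p :=
  ∫ r : ℝ, (1 + r ^ 2)⁻¹ • (DomAddAct.mk (y * r) +ᵥ f)

theorem continuous_vadd_Lp {p : ℝ≥0∞} [Fact (1 ≤ p)] (hp' : p ≠ ⊤) (f : LpR p) :
    Continuous fun c : ℝ => DomAddAct.mk c +ᵥ f := by
  have : Fact (p ≠ ⊤) := ⟨hp'⟩
  exact (DomAddAct.continuous_mk).vadd continuous_const

theorem continuous_poisson_integrand {p : ℝ≥0∞} [Fact (1 ≤ p)] (hp' : p ≠ ⊤) (f : LpR p) (y : ℝ) :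
    Continuous fun r : ℝ => (1 + r ^ 2)⁻¹ • (DomAddAct.mk (y * r) +ᵥ f) :=
  ((by fun_prop : Continuous fun r : ℝ => 1 + r ^ 2).inv₀ fun r => by positivity).smul
    ((continuous_vadd_Lp hp' f).comp (by fun_prop : Continuous fun r : ℝ => y * r))

theorem norm_poisson_integrand {p : ℝ≥0∞} [Fact (1 ≤ p)] (f : LpR p) (y r : ℝ) :
    ‖(1 + r ^ 2)⁻¹ • (DomAddAct.mk (y * r) +ᵥ f)‖ = (1 + r ^ 2)⁻¹ * ‖f‖ := by
  rw [norm_smul, DomAddAct.norm_vadd_Lp, Real.norm_of_nonneg (by positivity)]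

theorem tendsto_poissonLp {p : ℝ≥0∞} [Fact (1 ≤ p)] (hp' : p ≠ ⊤) (f : LpR p) :
    Tendsto (poissonLp f) (𝓝[>] 0) (𝓝 (Real.pi • f)) := by
  have h : ∫ r : ℝ, (1 + r ^ 2)⁻¹ • f = Real.pi • f := by
    rw [integral_smul_const, integral_univ_inv_one_add_sq]
  rw [← h]
  refine tendsto_integral_filter_of_dominated_convergence (fun r => (1 + r ^ 2)⁻¹ * ‖f‖)
    (Eventually.of_forall fun y => (continuous_poisson_integrand hp' f y).aestronglyMeasurable)
    (Eventually.of_forall fun y => Eventually.of_forall fun r => (norm_poisson_integrand f y r).le)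
    (integrable_inv_one_add_sq.mul_const _) (Eventually.of_forall fun r => ?_)
  have h1 : Continuous fun y : ℝ => (1 + r ^ 2)⁻¹ • (DomAddAct.mk (y * r) +ᵥ f) :=
    ((continuous_vadd_Lp hp' f).comp (by fun_prop : Continuous fun y : ℝ => y * r)).const_smul
      (1 + r ^ 2)⁻¹
  have h2 := (h1.tendsto 0).mono_left (nhdsWithin_le_nhds (s := Set.Ioi 0))
  simpa using h2

theorem coeFn_poissonLp {p : ℝ≥0∞} [Fact (1 ≤ p)] (hp' : p ≠ ⊤) (f : LpR p) (y : ℝ) :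
    (poissonLp f y : ℝ → ℂ) =ᵐ[volume]
      fun x => ∫ r : ℝ, ((1 + r ^ 2)⁻¹ : ℝ) * (f : ℝ → ℂ) (y * r + x) := by
  refine Lp_integral_ae_eq
    (k := fun r x => ((1 + r ^ 2)⁻¹ : ℝ) * (f : ℝ → ℂ) (y * r + x)) ?_ ?_ fun r => ?_
  · refine (integrable_inv_one_add_sq.mul_const ‖f‖).mono'
      (continuous_poisson_integrand hp' f y).aestronglyMeasurable
      (Eventually.of_forall fun r => (norm_poisson_integrand f y r).le)
  · refine StronglyMeasurable.aestronglyMeasurable (StronglyMeasurable.mul ?_ ?_)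
    · exact Measurable.stronglyMeasurable (by fun_prop)
    · exact (Lp.stronglyMeasurable f).comp_measurable
        (by fun_prop : Measurable fun z : ℝ × ℝ => y * z.1 + z.2)
  · filter_upwards [Lp.coeFn_smul ((1 + r ^ 2)⁻¹ : ℝ) (DomAddAct.mk (y * r) +ᵥ f),
      DomAddAct.vadd_Lp_ae_eq (DomAddAct.mk (y * r)) f] with x h1 h2
    rw [h1, Pi.smul_apply, h2]
    simp

/-- For `f` in the Hardy space the Poisson integral coincides with the Cauchy integral. -/
theorem poisson_eq_cauchyIntegral {p : ℝ≥0∞} [Fact (1 ≤ p)] (hp : 1 < p) (hp' : p ≠ ⊤)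
    {f : LpR p} (hf : f ∈ hardy p) {y : ℝ} (hy : 0 < y) (x : ℝ) :
    ∫ r : ℝ, ((1 + r ^ 2)⁻¹ : ℝ) * (f : ℝ → ℂ) (y * r + x) =
      Complex.I / 2 * ∫ s, f s * cauchyKernel (y * Complex.I - s) x := by
  obtain ⟨hq1, hq2⟩ := one_lt_conjExponent_ne_top hp hp'
  have hv : 0 < (y * Complex.I - x).im := by simpa using hy
  have hs : ∀ s : ℝ, 0 < (y * Complex.I - s).im := fun s => by simpa using hy
  have hm := memLp_cauchyKernel hq1 hq2 hv
  have hc : Continuous fun s : ℝ => cauchyKernel (y * Complex.I - s) x :=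
    (by fun_prop : Continuous fun s : ℝ => (x : ℂ) + (y * Complex.I - s)).inv₀
      fun s => ofReal_add_ne_zero (hs s) x
  have hm' : MemLp (fun s : ℝ => cauchyKernel (y * Complex.I - s) x)
      (ENNReal.conjExponent p) := by
    refine hm.of_le hc.aestronglyMeasurable (Eventually.of_forall fun s => le_of_eq ?_)
    rw [cauchyKernel, cauchyKernel, norm_inv, norm_inv, ← norm_neg, ← Complex.norm_conj]
    congr 2
    simp
    ring
  have h0 := hf _ hv
  have hi1 : Integrable fun s : ℝ => f s * cauchyKernel (y * Complex.I - x) s :=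
    (Lp.memLp f).integrable_mul (q := ENNReal.conjExponent p) hm
  have hi2 : Integrable fun s : ℝ => f s * cauchyKernel (y * Complex.I - s) x :=
    (Lp.memLp f).integrable_mul (q := ENNReal.conjExponent p) hm'
  have h1 : ∫ s : ℝ, f s * cauchyKernel (y * Complex.I - x) s = 0 := by
    rw [← h0]
    simp only [cauchyKernel, div_eq_mul_inv]
  let F : ℝ → ℂ := fun s => ((1 + ((s - x) / y) ^ 2)⁻¹ : ℝ) * f s
  have h2 : ∫ r : ℝ, ((1 + r ^ 2)⁻¹ : ℝ) * (f : ℝ → ℂ) (y * r + x) = (y⁻¹ : ℂ) * ∫ s, F s := by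
    have h3 := Measure.integral_comp_mul_left (fun z => F (z + x)) y
    rw [integral_add_right_eq_self F x, abs_of_pos (inv_pos.2 hy)] at h3
    rw [← Complex.ofReal_inv, ← Complex.real_smul, ← h3]
    congr 1 with r
    simp only [F]
    congr 4
    field_simp
    ring
  have hadd := integral_add hi2 hi1
  rw [h1, add_zero] at hadd
  rw [h2, ← hadd, ← integral_const_mul, ← integral_const_mul]
  congr 1 with s
  have n1 := ofReal_add_ne_zero (hs s) x
  have n2 := ofReal_add_ne_zero hv s
  have n3 : (y : ℂ) ≠ 0 := by exact_mod_cast hy.ne'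
  have n4 : (y : ℂ) ^ 2 + ((s : ℂ) - x) ^ 2 ≠ 0 := by
    have : (y : ℝ) ^ 2 + (s - x) ^ 2 ≠ 0 := by positivity
    exact_mod_cast this
  have n5 : (1 + (((s : ℂ) - x) / y) ^ 2)⁻¹ =
      (y : ℂ) ^ 2 / ((y : ℂ) ^ 2 + ((s : ℂ) - x) ^ 2) := by
    rw [div_pow, ← div_self (pow_ne_zero 2 n3), ← add_div, inv_div]
  have n6 : ((x : ℂ) + (y * Complex.I - s))⁻¹ + ((s : ℂ) + (y * Complex.I - x))⁻¹ =
      -(2 * y * Complex.I) / ((y : ℂ) ^ 2 + ((s : ℂ) - x) ^ 2) := by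
    rw [eq_div_iff n4]
    field_simp
    linear_combination (2 * (y : ℂ) ^ 3 * Complex.I) * Complex.I_sq
  simp only [F, cauchyKernel]
  push_cast
  rw [n5, ← mul_add, n6]
  field_simp
  linear_combination ((f : ℝ → ℂ) s) * Complex.I_sq

theorem poissonLp_mem {p : ℝ≥0∞} [Fact (1 ≤ p)] (hp : 1 < p) (hp' : p ≠ ⊤)
    {S : Submodule ℂ (LpR p)} (hS : IsClosed (S : Set (LpR p))) {t : ℝ}
    (hmem : ∀ (n : ℕ) (w : ℂ) (hw : 0 < w.im), w = n * Complex.I - t →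
      ∀ v, cauchyKernelMulLp hp hp' hw v ∈ S)
    {f : LpR p} (hf : f ∈ hardy p) {y : ℝ} (hy : 0 < y) : poissonLp f y ∈ S := by
  obtain ⟨k, hk⟩ := exists_nat_gt y
  let N : ℕ → ℕ := fun n => n + k
  let w : ℕ → ℂ := fun n => N n * Complex.I - t
  have hwim : ∀ n, (w n).im = N n := fun n => by simp [w]
  have hN : ∀ n, y < N n := fun n => hk.trans_le (by simp [N])
  have hw : ∀ n, 0 < (w n).im := fun n => by rw [hwim]; exact hy.trans (hN n)
  have hu : 0 < (y * Complex.I).im := by simpa using hy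
  choose h hhS hh using fun n => exists_mem_ae_eq_cauchyIntegral hp hp' hS hu (hw n)
    (by rw [hwim]; simpa using hN n) (hmem (N n) (w n) (hw n) rfl) f
  refine hS.mem_of_tendsto (f := fun n => (N n * Complex.I * (Complex.I / 2)) • h n)
    (b := atTop) ?_ (Eventually.of_forall fun n => S.smul_mem _ (hhS n))
  refine tendsto_Lp_of_dominated hp' (m := fun n x => N n * Complex.I * cauchyKernel (w n) x)
    (fun n => ?_) (fun n x => ?_) fun x => ?_
  · filter_upwards [Lp.coeFn_smul (N n * Complex.I * (Complex.I / 2) : ℂ) (h n), hh n,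
      coeFn_poissonLp hp' f y] with x h1 h2 h3
    rw [h1, Pi.smul_apply, h2, h3, poisson_eq_cauchyIntegral hp hp' hf hy, smul_eq_mul]
    ring
  · have h1 := norm_cauchyKernel_le (hw n) x
    rw [hwim] at h1
    have h2 : (0 : ℝ) < N n := hy.trans (hN n)
    simp only [norm_mul, Complex.norm_natCast, Complex.norm_I, mul_one]
    calc (N n : ℝ) * ‖cauchyKernel (w n) x‖ ≤ N n * (N n : ℝ)⁻¹ := by gcongr
      _ = 1 := mul_inv_cancel₀ h2.ne'
  · rw [tendsto_iff_norm_sub_tendsto_zero]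
    have hlim : Tendsto (fun n => (N n : ℝ)⁻¹ * ‖(x : ℂ) - t‖) atTop (𝓝 0) := by
      have : Tendsto (fun n => (N n : ℝ)⁻¹) atTop (𝓝 0) :=
        (tendsto_natCast_atTop_atTop.comp (tendsto_add_atTop_nat k)).inv_tendsto_atTop
      simpa using this.mul_const ‖(x : ℂ) - t‖
    refine squeeze_zero (fun _ => norm_nonneg _) (fun n => ?_) hlim
    have h1 : N n * Complex.I * cauchyKernel (w n) x - 1 = -(cauchyKernel (w n) x * (x - t)) := by
      have h2 := ofReal_add_ne_zero (hw n) x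
      simp only [cauchyKernel]
      field_simp
      simp only [w]
      ring
    rw [h1, norm_neg, norm_mul]
    gcongr
    simpa [hwim] using norm_cauchyKernel_le (hw n) x

theorem dense_rational_upperHalfPlane :
    Dense {u : {u : ℂ // 0 < u.im} | ∃ a b : ℚ, (u : ℂ) = (a : ℂ) + (b : ℂ) * Complex.I} := by
  have h1 : DenseRange fun q : ℚ × ℚ => ((q.1 : ℂ) + (q.2 : ℂ) * Complex.I) := by
    have h2 : DenseRange (Prod.map ((↑) : ℚ → ℝ) ((↑) : ℚ → ℝ)) :=
      Rat.denseRange_cast.prodMap Rat.denseRange_cast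
    have h3 := Complex.equivRealProdCLM.symm.surjective.denseRange.comp h2
      Complex.equivRealProdCLM.symm.continuous
    convert h3 using 2 with q
    apply Complex.ext <;> simp
  have hopen : IsOpen {u : ℂ | 0 < u.im} := isOpen_lt continuous_const Complex.continuous_im
  refine (Dense.preimage h1 hopen.isOpenMap_subtype_val).mono ?_
  rintro u ⟨q, hq⟩
  exact ⟨q.1, q.2, hq.symm⟩

/-- For every `t ∈ ℝ` and `p ∈ (1,∞)`, the closed linear span of the
countable set `Λ_t = {b_u·(D_t b_w) : u, w ∈ ℍ⁺_ℚ}` equals `H^p(ℝ)`, where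
`(D_t b_w)(x) = 1/(x - t + w)` and `ℍ⁺_ℚ` consists of the points of `ℍ⁺` with rational
real and imaginary parts. -/
theorem span_Lambda_t_dense_in_hardy
    (p : ℝ≥0∞) [Fact (1 ≤ p)] (hp : 1 < p) (hp' : p ≠ ⊤) (t : ℝ) :
    closure ((Submodule.span ℂ {f : LpR p | ∃ u w : ℂ,
        (∃ a b : ℚ, u = (a : ℂ) + (b : ℂ) * Complex.I) ∧ 0 < u.im ∧
        (∃ c d : ℚ, w = (c : ℂ) + (d : ℂ) * Complex.I) ∧ 0 < w.im ∧
        (f : ℝ → ℂ) =ᵐ[volume]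
          fun x => (1 / ((x : ℂ) + u)) * (1 / (((x : ℂ) - (t : ℂ)) + w))} :
      Submodule ℂ (LpR p)) : Set (LpR p)) = hardy p := by
  set s : Set (LpR p) := {f : LpR p | ∃ u w : ℂ,
        (∃ a b : ℚ, u = (a : ℂ) + (b : ℂ) * Complex.I) ∧ 0 < u.im ∧
        (∃ c d : ℚ, w = (c : ℂ) + (d : ℂ) * Complex.I) ∧ 0 < w.im ∧
        (f : ℝ → ℂ) =ᵐ[volume]
          fun x => (1 / ((x : ℂ) + u)) * (1 / (((x : ℂ) - (t : ℂ)) + w))}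
  refine Set.Subset.antisymm ?_ ?_
  · refine closure_minimal (span_le_hardy hp hp' ?_) (isClosed_hardy hp hp')
    rintro f ⟨u, w, -, hu, -, hw, hf⟩ v hv
    have hw' : 0 < (w - t).im := by simpa using hw
    rw [← integral_cauchyKernel_mul_mul hu hw' hv]
    refine integral_congr_ae ?_
    filter_upwards [hf] with x hx
    rw [hx]
    simp only [cauchyKernel, div_eq_mul_inv, one_mul]
    congr 3
    ring
  · intro f hf
    set S := (Submodule.span ℂ s).topologicalClosure
    have hS : IsClosed (S : Set (LpR p)) := Submodule.isClosed_topologicalClosure _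
    have hmem : ∀ (n : ℕ) (w : ℂ) (hw : 0 < w.im), w = n * Complex.I - t →
        ∀ v, cauchyKernelMulLp hp hp' hw v ∈ S := by
      intro n w hw hwn v
      refine isClosed_property dense_rational_upperHalfPlane.denseRange_val
        (hS.preimage (continuous_cauchyKernelMulLp hp hp' hw)) (fun u => ?_) v
      refine Submodule.le_topologicalClosure _ (Submodule.subset_span ?_)
      refine ⟨u.1, w + t, u.2, u.1.2, ⟨0, n, by simp [hwn]⟩, by simpa using hw, ?_⟩
      filter_upwards [coeFn_cauchyKernelMulLp hp hp' hw u.1] with x hx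
      rw [hx]
      simp [cauchyKernel]
    have h1 : Real.pi • f ∈ S := by
      refine hS.mem_of_tendsto (tendsto_poissonLp hp' f) ?_
      filter_upwards [self_mem_nhdsWithin] with y hy
      exact poissonLp_mem hp hp' hS hmem hf hy
    rw [← Submodule.topologicalClosure_coe]
    have h2 := S.smul_mem ((Real.pi : ℂ)⁻¹) h1
    rwa [RCLike.real_smul_eq_coe_smul (K := ℂ) Real.pi f, RCLike.ofReal_eq_complex_ofReal, smul_smul,
      inv_mul_cancel₀ (by exact_mod_cast Real.pi_ne_zero), one_smul] at h2

end
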